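/- None of the four equations Y² = X^{11} + 691, Y² = X^{11} − 691, Y² = 5X^{22} + 2764, and Y² = 5X^{22} − 2764 has a solution in integers X, Y. (Here 2764 = 4·691.) -/

import Mathlib

/-- Gauss reduction of integral binary quadratic forms of nonsquare discriminant `D`: every value
of the reduced form `(a', b', c')` is also a value of `(a, b, c)`. -/
lemma exists_reduced_form {D : ℤ} (hD : ¬ IsSquare D) (n : ℕ) :
    ∀ a b c : ℤ, a.natAbs = n → b ^ 2 - 4 * a * c = D →
      ∃ a' b' c' : ℤ, b' ^ 2 - 4 * a' * c' = D ∧ |b'| ≤ |a'| ∧ |a'| ≤ |c'| ∧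
        ∀ x y : ℤ, ∃ x' y' : ℤ,
          a * x' ^ 2 + b * x' * y' + c * y' ^ 2 = a' * x ^ 2 + b' * x * y + c' * y ^ 2 := by
  induction n using Nat.strong_induction_on with
  | _ n ih =>
    intro a b c hn hdisc
    have ha : a ≠ 0 := by
      rintro rfl
      exact hD ⟨b, by rw [← hdisc]; ring⟩
    obtain ⟨k, hk⟩ : ∃ k : ℤ, |b + 2 * a * k| ≤ |a| := by
      have h₁ : 0 ≤ (b + |a|) % (2 * |a|) := Int.emod_nonneg _ (by positivity)
      have h₂ : (b + |a|) % (2 * |a|) < 2 * |a| := Int.emod_lt_of_pos _ (by positivity)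
      have h₃ := Int.emod_add_mul_ediv (b + |a|) (2 * |a|)
      generalize (b + |a|) / (2 * |a|) = q at h₃
      rcases abs_choice a with h | h
      · refine ⟨-q, abs_le.2 ?_⟩
        rw [h] at h₁ h₂ h₃ ⊢
        constructor <;> linarith
      · refine ⟨q, abs_le.2 ?_⟩
        rw [h] at h₁ h₂ h₃ ⊢
        constructor <;> linarith
    by_cases hac : |a| ≤ |a * k ^ 2 + b * k + c|
    · refine ⟨a, b + 2 * a * k, a * k ^ 2 + b * k + c, by rw [← hdisc]; ring, hk, hac,
        fun x y ↦ ⟨x + k * y, y, by ring⟩⟩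
    · obtain ⟨a', b', c', h₁, h₂, h₃, h₄⟩ := ih (a * k ^ 2 + b * k + c).natAbs
        (by rw [← hn]; exact by zify; exact not_le.1 hac)
        (a * k ^ 2 + b * k + c) (-(b + 2 * a * k)) a rfl (by rw [← hdisc]; ring)
      refine ⟨a', b', c', h₁, h₂, h₃, fun x y ↦ ?_⟩
      obtain ⟨x', y', h⟩ := h₄ x y
      exact ⟨-y' + k * x', x', by rw [← h]; ring⟩

/-- Up to sign of the first coordinate, vectors at which the reduced forms of discriminant `2764`
take the value `1` or `-1`. -/
def unitVectors : List (ℤ × ℤ) :=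
  [(1, 0), (59, 7), (617, 122), (1349, 1227), (6379, 2576), (16683, 14107), (75687, 44897),
    (31314427, 14791965), (2683936691, 212279001), (5443563704, 5655842705),
    (329236860574, 78120402865), (641718472034, 719838874899), (3442953568765, 1361557346933),
    (174739274446329545, 165082837488005187), (504904949422339919, 339822111934334732),
    (2, 1), (4, 3)]

lemma reduced_form_2764_represents_unit :
    ∀ a ∈ Finset.Icc (-26 : ℤ) 26, ∀ b ∈ Finset.Icc (-26 : ℤ) 26,
      (b ^ 2 - 2764) % (4 * a) = 0 → a ≠ 0 → |b| ≤ |a| → |a| ≤ |(b ^ 2 - 2764) / (4 * a)| →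
      ∃ v ∈ unitVectors, ∃ s ∈ [(1 : ℤ), -1],
        (a * (s * v.1) ^ 2 + b * (s * v.1) * v.2 + (b ^ 2 - 2764) / (4 * a) * v.2 ^ 2) ^ 2 = 1 := by
  decide +kernel

lemma form_2764_represents_unit {a b c : ℤ} (h : b ^ 2 - 4 * a * c = 2764) :
    ∃ x y : ℤ, (a * x ^ 2 + b * x * y + c * y ^ 2) ^ 2 = 1 := by
  obtain ⟨a', b', c', h₁, h₂, h₃, h₄⟩ :=
    exists_reduced_form (by norm_num) _ a b c rfl h
  have hb : b' ^ 2 ≤ a' ^ 2 := sq_le_sq.2 h₂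
  have hc : |a'| ^ 2 ≤ |a' * c'| := by
    rw [abs_mul, sq]; gcongr
  rw [sq_abs] at hc
  have ha : a' ≠ 0 := by
    rintro rfl
    rw [abs_zero, abs_nonpos_iff] at h₂
    norm_num [h₂] at h₁
  have ha2 : a' ^ 2 ≤ 691 := by
    rcases abs_choice (a' * c') with h' | h' <;> rw [h'] at hc <;> nlinarith [sq_nonneg b']
  have ha3 : |a'| ≤ 26 := by
    rw [← sq_abs] at ha2
    nlinarith [abs_nonneg a']
  have ha4 := abs_le.1 ha3
  have hb4 := abs_le.1 (h₂.trans ha3)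
  have hdiv : b' ^ 2 - 2764 = 4 * a' * c' := by linarith
  have hc' : (b' ^ 2 - 2764) / (4 * a') = c' := by
    rw [hdiv]; exact Int.mul_ediv_cancel_left _ (by omega)
  obtain ⟨v, -, s, -, hv⟩ := reduced_form_2764_represents_unit a' (Finset.mem_Icc.2 ha4) b'
    (Finset.mem_Icc.2 hb4) (by rw [hdiv]; exact Int.mul_emod_right _ _) ha h₂ (by rwa [hc'])
  rw [hc'] at hv
  obtain ⟨x, y, hxy⟩ := h₄ (s * v.1) v.2
  exact ⟨x, y, by rw [hxy]; exact hv⟩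

lemma pow_eleven_pow_eight (x : ZMod 89) : (x ^ 11) ^ 8 = 0 ∨ (x ^ 11) ^ 8 = 1 := by
  revert x; decide +kernel

/-- An explicit solution of the Pell equation `x ^ 2 - 691 * y ^ 2 = 1`. -/
def pellSolution : Pell.Solution₁ 691 :=
  .mk 31138100617500578690 1184549173291009383 (by norm_num)

lemma pow_eleven_pow_six (x : ZMod 67) : (x ^ 11) ^ 6 = 0 ∨ (x ^ 11) ^ 6 = 1 := by
  revert x; decide +kernel

/-- Multiplicative maps from Pell solutions to a commutative monoid with square root `r` of `691`. -/
def pellHom {n : ℕ} (r : ZMod n) (hr : r * r = ((691 : ℤ) : ZMod n)) :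
    Pell.Solution₁ 691 →* (ZMod n)ˣ :=
  MonoidHom.toHomUnits
    { toFun u := Zsqrtd.lift ⟨r, hr⟩ (u : ℤ√691)
      map_one' := map_one (Zsqrtd.lift ⟨r, hr⟩)
      map_mul' u v := map_mul (Zsqrtd.lift ⟨r, hr⟩) (u : ℤ√691) v }

lemma coe_pellHom {n : ℕ} (r : ZMod n) (hr : r * r = ((691 : ℤ) : ZMod n))
    (u : Pell.Solution₁ 691) :
    (pellHom r hr u : ZMod n) = u.x + u.y * r := rfl

lemma pellHom_neg_pow {n k : ℕ} (hk : Even k) (r : ZMod n) (hr : r * r = ((691 : ℤ) : ZMod n))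
    (u : Pell.Solution₁ 691) :
    pellHom r hr (-u) ^ k = pellHom r hr u ^ k := by
  ext
  rw [Units.val_pow_eq_pow_val, Units.val_pow_eq_pow_val, coe_pellHom, coe_pellHom]
  rw [← hk.neg_pow]
  simp only [Pell.Solution₁.x_neg, Pell.Solution₁.y_neg]
  push_cast
  ring

/-- The unit `pellSolution` is an eleventh power modulo both primes above `89`, hence so are all
units, as it is not an eleventh power itself (look modulo `67`). -/
lemma pellHom_pow_eight (r : ZMod 89) (hr : r * r = ((691 : ℤ) : ZMod 89))
    (u : Pell.Solution₁ 691) : pellHom r hr u ^ 8 = 1 := by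
  obtain ⟨ε, hε⟩ := Pell.IsFundamental.exists_of_not_isSquare (d := 691) (by norm_num)
    (by norm_num)
  have hr' : ∀ r : ZMod 89, r * r = ((691 : ℤ) : ZMod 89) →
      (((pellSolution.x : ℤ) : ZMod 89) + ((pellSolution.y : ℤ) : ZMod 89) * r) ^ 8 = 1 := by
    decide +kernel
  have key : pellHom r hr ε ^ 8 = 1 := by
    obtain ⟨m, hm⟩ := hε.eq_zpow_or_neg_zpow pellSolution
    have h11 : ¬ (11 : ℤ) ∣ m := by
      rintro ⟨k, rfl⟩
      have h : pellHom (n := 67) 17 (by decide) pellSolution ^ 6 =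
          ((pellHom 17 (by decide) (ε ^ k)) ^ 11) ^ 6 := by
        rw [← map_pow _ (ε ^ k), ← zpow_natCast (ε ^ k), ← zpow_mul, mul_comm k]
        rcases hm with h | h
        · rw [h]; rfl
        · rw [h, pellHom_neg_pow (by decide)]; rfl
      have h' := congrArg Units.val h
      simp only [Units.val_pow_eq_pow_val] at h'
      have h2 : ((pellHom (n := 67) 17 (by decide) pellSolution : (ZMod 67)ˣ) : ZMod 67) ^ 6 ≠ 0 ∧
          ((pellHom (n := 67) 17 (by decide) pellSolution : (ZMod 67)ˣ) : ZMod 67) ^ 6 ≠ 1 := by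
        rw [coe_pellHom]
        decide +kernel
      rcases pow_eleven_pow_six (pellHom (n := 67) 17 (by decide) (ε ^ k)) with h3 | h3
      · exact h2.1 (h'.trans h3)
      · exact h2.2 (h'.trans h3)
    have : Fact (Nat.Prime 89) := ⟨by norm_num⟩
    have h88 : (pellHom r hr ε ^ 8) ^ (11 : ℤ) = 1 := by
      have := ZMod.units_pow_card_sub_one_eq_one 89 (pellHom r hr ε)
      rw [show (11 : ℤ) = (11 : ℕ) from rfl, zpow_natCast, ← pow_mul]
      exact this
    have hm8 : (pellHom r hr ε ^ 8) ^ m = 1 := by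
      have h0 : pellHom r hr pellSolution ^ 8 = 1 := by
        ext
        rw [Units.val_pow_eq_pow_val, coe_pellHom, hr' r hr, Units.val_one]
      rw [← h0, ← zpow_natCast, ← zpow_mul, mul_comm, zpow_mul, ← map_zpow, zpow_natCast]
      rcases hm with h | h
      · rw [h]
      · rw [h, pellHom_neg_pow (by decide)]
    have hcop : IsCoprime (11 : ℤ) m :=
      (Prime.coprime_iff_not_dvd (by norm_num [Int.prime_iff_natAbs_prime])).2 h11
    obtain ⟨s, t, hst⟩ := hcop
    calc pellHom r hr ε ^ 8 = (pellHom r hr ε ^ 8) ^ (s * 11 + t * m) := by rw [hst, zpow_one]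
      _ = 1 := by
        rw [zpow_add, mul_comm s, mul_comm t, zpow_mul, zpow_mul, h88, hm8, one_zpow, one_zpow,
          one_mul]
  obtain ⟨k, hk | hk⟩ := hε.eq_zpow_or_neg_zpow u
  · rw [hk, map_zpow, ← zpow_natCast, ← zpow_mul, mul_comm, zpow_mul, zpow_natCast, key, one_zpow]
  · rw [hk, pellHom_neg_pow (by decide), map_zpow, ← zpow_natCast, ← zpow_mul, mul_comm, zpow_mul,
      zpow_natCast, key, one_zpow]

theorem sq_ne_pow_eleven_add (X Y : ℤ) : Y ^ 2 ≠ X ^ 11 + 691 := by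
  intro hXY
  have hX : X ≠ 0 := by
    rintro rfl
    have : Y % 4 = 0 ∨ Y % 4 = 1 ∨ Y % 4 = 2 ∨ Y % 4 = 3 := by omega
    have h4 := congrArg (· % 4) hXY
    rcases this with h | h | h | h <;> simp [pow_two, Int.mul_emod, h] at h4
  obtain ⟨x, y, hxy⟩ := form_2764_represents_unit (a := X) (b := 2 * Y) (c := X ^ 10)
    (by linear_combination 4 * hXY)
  set e := X * x ^ 2 + 2 * Y * x * y + X ^ 10 * y ^ 2 with he
  set s : ℤ√691 := ⟨Y, 1⟩ with hs
  set α : ℤ√691 := X * x + s * y with hα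
  have hsnorm : s.norm = X ^ 11 := by
    rw [Zsqrtd.norm_def, hs]; linear_combination hXY
  have hαnorm : α.norm = X * e := by
    rw [Zsqrtd.norm_def, hα, hs, he]
    simp
    linear_combination y ^ 2 * hXY
  obtain ⟨u, hu⟩ : s ∣ α ^ 11 := by
    have h₁ : s ∣ α - X * x := ⟨y, by rw [hα]; ring⟩
    have h₂ : s ∣ (X * x : ℤ√691) ^ 11 := by
      rw [mul_pow]
      refine Dvd.dvd.mul_right ⟨star s, ?_⟩ _
      rw [← Zsqrtd.norm_eq_mul_conj, hsnorm]
      push_cast; ring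
    exact (dvd_sub_left h₂).1 (h₁.trans (sub_dvd_pow_sub_pow _ _ 11))
  have hunorm : u.norm = e ^ 11 := by
    have h := congrArg Zsqrtd.norm hu
    change Zsqrtd.normMonoidHom _ = _ at h
    rw [map_pow, Zsqrtd.norm_mul, hsnorm] at h
    change α.norm ^ 11 = _ at h
    rw [hαnorm, mul_pow] at h
    exact (mul_left_cancel₀ (pow_ne_zero 11 hX) h).symm
  have hu1 : u.re ^ 2 - 691 * u.im ^ 2 = 1 := by
    have h : u.re ^ 2 - 691 * u.im ^ 2 = e ^ 11 := by
      rw [← hunorm, Zsqrtd.norm_def]; ring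
    rcases sq_eq_sq_iff_eq_or_eq_neg.1 (hxy.trans (one_pow 2).symm) with h' | h'
    · rw [h, h']; norm_num
    · exfalso
      rw [h'] at h
      have h4 := congrArg (fun z : ℤ ↦ (z : ZMod 4)) h
      push_cast at h4
      revert h4
      generalize (u.re : ZMod 4) = p
      generalize (u.im : ZMod 4) = q
      revert p q
      decide
  have key : ∀ (r : ZMod 89) (_ : r * r = ((691 : ℤ) : ZMod 89)),
      ((Y : ZMod 89) + r) ^ 8 = 0 ∨ ((Y : ZMod 89) + r) ^ 8 = 1 := by
    intro r hr
    have h := congrArg (Zsqrtd.lift ⟨r, hr⟩) hu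
    rw [map_pow, map_mul] at h
    have hu8 : (Zsqrtd.lift ⟨r, hr⟩ u) ^ 8 = 1 := by
      have := congrArg Units.val (pellHom_pow_eight r hr (.mk u.re u.im hu1))
      simpa [coe_pellHom] using this
    have hs8 : Zsqrtd.lift ⟨r, hr⟩ s = Y + r := by simp [hs]
    have := pow_eleven_pow_eight (Zsqrtd.lift ⟨r, hr⟩ α)
    rwa [h, mul_pow, hu8, mul_one, hs8] at this
  have hfin : ∀ y : ZMod 89, ¬ (((y + 35) ^ 8 = 0 ∨ (y + 35) ^ 8 = 1) ∧
      ((y + -35) ^ 8 = 0 ∨ (y + -35) ^ 8 = 1)) := by decide +kernel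
  exact hfin Y ⟨key 35 (by decide), key (-35) (by decide)⟩

lemma reduced_form_neg_691 :
    ∀ a ∈ Finset.Icc (1 : ℤ) 15, ∀ b ∈ Finset.Icc (-15 : ℤ) 15,
      (b ^ 2 + 691) % (4 * a) = 0 → |b| ≤ a → a ≤ (b ^ 2 + 691) / (4 * a) →
      a = 1 ∨ a = 5 ∨ a = 7 := by
  decide +kernel

lemma form_neg_691_represents {a b c : ℤ} (ha : 0 < a) (h : b ^ 2 - 4 * a * c = -691) :
    ∃ x y : ℤ, a * x ^ 2 + b * x * y + c * y ^ 2 = 1 ∨ a * x ^ 2 + b * x * y + c * y ^ 2 = 5 ∨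
      a * x ^ 2 + b * x * y + c * y ^ 2 = 7 := by
  obtain ⟨a', b', c', h₁, h₂, h₃, h₄⟩ := exists_reduced_form
    (fun hs ↦ absurd hs.nonneg (by norm_num)) _ a b c rfl h
  have hpos : 0 < a' := by
    obtain ⟨x, y, hxy⟩ := h₄ 1 0
    have h0 : 0 ≤ 4 * a * a' := by
      have : 4 * a * a' = (2 * a * x + b * y) ^ 2 + 691 * y ^ 2 := by
        linear_combination -4 * a * hxy - y ^ 2 * h
      rw [this]; positivity
    rcases lt_trichotomy a' 0 with h' | h' | h'
    · nlinarith
    · rw [h'] at h₁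
      nlinarith [sq_nonneg b']
    · exact h'
  rw [abs_of_pos hpos] at h₂ h₃
  have hc' : 0 < c' := by nlinarith [sq_nonneg b']
  rw [abs_of_pos hc'] at h₃
  have hb : b' ^ 2 ≤ a' ^ 2 := sq_le_sq' (abs_le.1 h₂).1 (abs_le.1 h₂).2
  have ha' : a' ≤ 15 := by nlinarith
  have hb' := abs_le.1 (h₂.trans ha')
  have hdiv : b' ^ 2 + 691 = 4 * a' * c' := by linarith
  have hc : (b' ^ 2 + 691) / (4 * a') = c' := by
    rw [hdiv]; exact Int.mul_ediv_cancel_left _ (by omega)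
  have hcase := reduced_form_neg_691 a' (Finset.mem_Icc.2 ⟨hpos, ha'⟩) b' (Finset.mem_Icc.2 hb')
    (by rw [hdiv]; exact Int.mul_emod_right _ _) h₂ (by rwa [hc])
  obtain ⟨x, y, hxy⟩ := h₄ 1 0
  refine ⟨x, y, ?_⟩
  rw [hxy]
  simpa using hcase

lemma sq_dvd_pow_eleven {R : Type*} [CommRing R] {s X : R} (h : s ∣ X ^ 11) (t y : R) :
    s ^ 2 ∣ (X ^ 2 * t + s * y) ^ 11 := by
  obtain ⟨k, hk⟩ := Polynomial.powAddExpansion (X ^ 2 * t) (s * y) 11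
  obtain ⟨l, hl⟩ := h
  refine ⟨l ^ 2 * t ^ 11 + 11 * (l * X ^ 9 * t ^ 10 * y) + k * y ^ 2, ?_⟩
  rw [hk]
  push_cast
  linear_combination (t ^ 11 * (X ^ 11 + s * l) + 11 * X ^ 9 * t ^ 10 * s * y) * hl

/-- The ring of integers of `ℚ(√-691)`, generated by `ω` with `ω ^ 2 = ω - 173`. -/
abbrev QuadraticInt : Type := QuadraticAlgebra ℤ (-173) 1

lemma four_mul_norm (z : QuadraticInt) :
    4 * z.norm = (2 * z.re + z.im) ^ 2 + 691 * z.im ^ 2 := by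
  rw [QuadraticAlgebra.norm_def]; ring

lemma sq_pow_half_mod_ne {m : ℕ} (hm : m.Prime) (hm2 : m % 2 = 1) (p : ℕ) :
    (p ^ 2 % m) ^ (m / 2) % m ≠ m - 1 := by
  have := hm.two_le
  rw [← Nat.pow_mod, ← pow_mul, show 2 * (m / 2) = m - 1 by omega]
  by_cases h : m ∣ p
  · rw [Nat.mod_eq_zero_of_dvd (dvd_pow h (by omega))]
    omega
  · have h₁ := Nat.ModEq.pow_totient ((hm.coprime_iff_not_dvd.2 h).symm)
    rw [Nat.totient_prime hm, Nat.ModEq, Nat.mod_eq_of_lt (by omega : 1 < m)] at h₁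
    omega

/-- Odd primes used to show that integers are not squares. -/
def sievePrimes : List ℕ :=
  [3, 5, 7, 11, 13, 17, 19, 23, 29, 31, 37, 41, 43, 47, 53, 59, 61]

/-- For `q = 64 * i + j ≠ v` with `i < N` and `j < 64`, the difference `n - 691 * q ^ 2` is a
nonresidue modulo one of the `sievePrimes`, or is negative. -/
def NormFormSieve (n v N : ℕ) : Prop :=
  ∀ i < N, ∀ j < 64, 691 * (64 * i + j) ^ 2 ≤ n → 64 * i + j = v ∨
    ∃ m ∈ sievePrimes, ((n - 691 * (64 * i + j) ^ 2) % m) ^ (m / 2) % m = m - 1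

instance (n v N : ℕ) : Decidable (NormFormSieve n v N) := by
  unfold NormFormSieve; infer_instance

lemma NormFormSieve.eq_or_eq_neg {n v N u : ℕ} (h : NormFormSieve n v N)
    (hN : n < 691 * (64 * N) ^ 2) (huv : u ^ 2 + 691 * v ^ 2 = n) {p q : ℤ}
    (hpq : p ^ 2 + 691 * q ^ 2 = n) : (p = u ∨ p = -u) ∧ (q = v ∨ q = -v) := by
  have hn : p.natAbs ^ 2 + 691 * q.natAbs ^ 2 = n := by
    zify; rw [sq_abs, sq_abs]; exact hpq
  have hq : q.natAbs < 64 * N := by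
    by_contra! hc
    have := Nat.pow_le_pow_left hc 2
    omega
  have hv : q.natAbs = v := by
    have hdiv := Nat.div_add_mod q.natAbs 64
    have hs := h (q.natAbs / 64) (by omega) (q.natAbs % 64) (by omega)
    rw [hdiv, show n - 691 * q.natAbs ^ 2 = p.natAbs ^ 2 by omega] at hs
    rcases hs (by omega) with hs | ⟨m, hm, hs⟩
    · exact hs
    · have hprime : ∀ m ∈ sievePrimes, m.Prime ∧ m % 2 = 1 := by
        simp only [sievePrimes, List.forall_mem_cons]
        norm_num
      exact absurd hs (sq_pow_half_mod_ne (hprime m hm).1 (hprime m hm).2 _)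
  have hu : p.natAbs = u := by
    rw [hv] at hn
    exact Nat.pow_left_injective two_ne_zero (by simp only; omega)
  omega

/-- Absolute values of the solutions `(u, v)` of `u ^ 2 + 691 * v ^ 2 = 4 * e ^ 11` for `e` equal to
`1`, `5` and `7`. -/
def normFormSolutions : List (ℤ × ℤ) := [(2, 0), (4750, 500), (84721, 1029)]

lemma sieve_neg_691 : ∀ P ∈ normFormSolutions, ∀ σ ∈ [(1 : ℤ), -1], ∀ τ ∈ [(1 : ℤ), -1], ∀ y : ZMod 89,
    ¬ (((((y - 1 + 2 * 17) ^ 2 * (45 * (σ * P.1 - τ * P.2 : ℤ) + (τ * P.2 : ℤ) * 17)) ^ 8 = 0) ∨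
      (((y - 1 + 2 * 17) ^ 2 * (45 * (σ * P.1 - τ * P.2 : ℤ) + (τ * P.2 : ℤ) * 17)) ^ 8 = 1)) ∧
      ((((y - 1 + 2 * 73) ^ 2 * (45 * (σ * P.1 - τ * P.2 : ℤ) + (τ * P.2 : ℤ) * 73)) ^ 8 = 0) ∨
      (((y - 1 + 2 * 73) ^ 2 * (45 * (σ * P.1 - τ * P.2 : ℤ) + (τ * P.2 : ℤ) * 73)) ^ 8 = 1))) := by
  decide +kernel

lemma exists_normFormSolution {p q e : ℤ} (he : e = 1 ∨ e = 5 ∨ e = 7)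
    (h : p ^ 2 + 691 * q ^ 2 = 4 * e ^ 11) :
    ∃ P ∈ normFormSolutions, ∃ σ ∈ [(1 : ℤ), -1], ∃ τ ∈ [(1 : ℤ), -1],
      p = σ * P.1 ∧ q = τ * P.2 := by
  have aux : ∀ P ∈ normFormSolutions, (p = P.1 ∨ p = -P.1) ∧ (q = P.2 ∨ q = -P.2) →
      ∃ P ∈ normFormSolutions, ∃ σ ∈ [(1 : ℤ), -1], ∃ τ ∈ [(1 : ℤ), -1],
        p = σ * P.1 ∧ q = τ * P.2 := by
    rintro P hP ⟨h₁, h₂⟩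
    obtain ⟨σ, hσ, h₁⟩ : ∃ σ ∈ [(1 : ℤ), -1], p = σ * P.1 := by simpa using h₁
    obtain ⟨τ, hτ, h₂⟩ : ∃ τ ∈ [(1 : ℤ), -1], q = τ * P.2 := by simpa using h₂
    exact ⟨P, hP, σ, hσ, τ, hτ, h₁, h₂⟩
  rcases he with rfl | rfl | rfl <;> norm_num at h
  · exact aux (2, 0) (by simp [normFormSolutions])
      (NormFormSieve.eq_or_eq_neg (n := 4) (v := 0) (N := 1) (u := 2) (by decide +kernel)
        (by norm_num) (by norm_num) h)
  · exact aux (4750, 500) (by simp [normFormSolutions])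
      (NormFormSieve.eq_or_eq_neg (n := 195312500) (v := 500) (N := 9) (u := 4750)
        (by decide +kernel) (by norm_num) (by norm_num) h)
  · exact aux (84721, 1029) (by simp [normFormSolutions])
      (NormFormSieve.eq_or_eq_neg (n := 7909306972) (v := 1029) (N := 53) (u := 84721)
        (by decide +kernel) (by norm_num) (by norm_num) h)

theorem sq_ne_pow_eleven_sub (X Y : ℤ) : Y ^ 2 ≠ X ^ 11 - 691 := by
  intro hXY
  have hodd : X % 2 = 1 := by
    by_contra hX
    obtain ⟨k, rfl⟩ : (2 : ℤ) ∣ X := by omega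
    have h8 : (Y ^ 2) % 8 = 5 := by rw [hXY]; ring_nf; omega
    have : Y % 8 = 0 ∨ Y % 8 = 1 ∨ Y % 8 = 2 ∨ Y % 8 = 3 ∨ Y % 8 = 4 ∨ Y % 8 = 5 ∨ Y % 8 = 6 ∨
      Y % 8 = 7 := by omega
    rcases this with h | h | h | h | h | h | h | h <;> simp [pow_two, Int.mul_emod, h] at h8
  have hX : X ≠ 0 := by rintro rfl; simp at hodd
  obtain ⟨m, hm⟩ : ∃ m, X = 2 * m + 1 := ⟨X / 2, by omega⟩
  have hYeven : Even Y := by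
    have : Even (Y ^ 2) := by
      rw [hXY]
      exact Odd.sub_odd (Odd.pow ⟨m, hm⟩) (by decide)
    exact (Int.even_pow.1 this).1
  obtain ⟨g, hg⟩ : ∃ g, Y + X ^ 2 = 2 * g + 1 :=
    Even.add_odd hYeven (Odd.pow ⟨m, hm⟩)
  obtain ⟨c, hc⟩ : ∃ c, (Y + X ^ 2) ^ 2 + 691 = 4 * X ^ 2 * c := by
    have h₁ : (4 : ℤ) ∣ (Y + X ^ 2) ^ 2 + 691 :=
      ⟨g ^ 2 + g + 173, by rw [hg]; ring⟩
    have h₂ : X ^ 2 ∣ (Y + X ^ 2) ^ 2 + 691 :=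
      ⟨X ^ 9 + 2 * Y + X ^ 2, by linear_combination hXY⟩
    have hcop : IsCoprime (4 : ℤ) (X ^ 2) := by
      refine IsCoprime.pow_right ?_
      rw [show (4 : ℤ) = 2 ^ 2 by norm_num]
      exact IsCoprime.pow_left ⟨-m, 1, by rw [hm]; ring⟩
    obtain ⟨c, hc⟩ := hcop.mul_dvd h₁ h₂
    exact ⟨c, hc⟩
  obtain ⟨x, y, hxy⟩ := form_neg_691_represents (a := X ^ 2) (b := Y + X ^ 2) (c := c)
    (by positivity) (by linarith)
  set e := X ^ 2 * x ^ 2 + (Y + X ^ 2) * x * y + c * y ^ 2 with he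
  set s : QuadraticInt := ⟨Y - 1, 2⟩ with hs
  set β : QuadraticInt := ⟨X ^ 2 * x + g * y, y⟩ with hβ
  have hsnorm : s.norm = X ^ 11 := by
    rw [QuadraticAlgebra.norm_def, hs]; linear_combination hXY
  have hβnorm : β.norm = X ^ 2 * e := by
    have := four_mul_norm β
    have h : 4 * β.norm = 4 * (X ^ 2 * e) := by
      rw [this, he, hβ]
      linear_combination (-(4 * X ^ 2 * x + (2 * g + Y + X ^ 2 + 1) * y) * y) * hg + y ^ 2 * hc
    exact mul_left_cancel₀ (by norm_num) h
  have hsdvd : s ∣ (X : QuadraticInt) ^ 11 := by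
    refine ⟨star s, ?_⟩
    rw [← QuadraticAlgebra.algebraMap_norm_eq_mul_star, hsnorm]
    simp
  have h2β : (2 : QuadraticInt) * β = X ^ 2 * (2 * x + y : ℤ) + s * (y : ℤ) := by
    rw [← Int.cast_pow, show (2 : QuadraticInt) = ⟨2, 0⟩ by ext <;> rfl]
    generalize ht : 2 * x + y = t
    ext
    · simp [-Int.cast_pow, -Int.cast_npow, hβ, hs]
      linear_combination -y * hg + X ^ 2 * ht
    · simp [-Int.cast_pow, -Int.cast_npow, hβ, hs]
  obtain ⟨δ, hδ⟩ : s ^ 2 ∣ β ^ 11 := by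
    have h₁ : s ^ 2 ∣ 2 ^ 11 * β ^ 11 := by
      rw [← mul_pow, h2β]
      exact sq_dvd_pow_eleven hsdvd _ _
    have h₂ : IsCoprime s (2 : QuadraticInt) := by
      have h₃ : IsCoprime ((X : QuadraticInt) ^ 11) (2 : QuadraticInt) := by
        refine IsCoprime.pow_left ⟨1, -m, ?_⟩
        rw [hm]; push_cast; ring
      exact h₃.of_isCoprime_of_dvd_left hsdvd
    exact (h₂.pow (m := 2) (n := 11)).dvd_of_dvd_mul_left h₁
  have hδnorm : δ.norm = e ^ 11 := by
    have h := congrArg QuadraticAlgebra.norm hδ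
    rw [map_pow, map_mul, map_pow, hsnorm, hβnorm, mul_pow] at h
    exact (mul_left_cancel₀ (pow_ne_zero 22 hX) (by linear_combination h)).symm
  have h4 := four_mul_norm δ
  rw [hδnorm] at h4
  have key : ∀ (w : ZMod 89) (_ : w * w = (-173 : ℤ) • (1 : ZMod 89) + (1 : ℤ) • w),
      (((Y : ZMod 89) - 1 + 2 * w) ^ 2 * (δ.re + δ.im * w)) ^ 8 = 0 ∨
      (((Y : ZMod 89) - 1 + 2 * w) ^ 2 * (δ.re + δ.im * w)) ^ 8 = 1 := by
    intro w hw
    have h := congrArg (QuadraticAlgebra.lift (R := ℤ) (A := ZMod 89) ⟨w, hw⟩) hδ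
    rw [map_pow, map_mul, map_pow] at h
    have := pow_eleven_pow_eight (QuadraticAlgebra.lift (R := ℤ) (A := ZMod 89) ⟨w, hw⟩ β)
    rw [h] at this
    simpa [hs] using this
  obtain ⟨P, hP, σ, hσ, τ, hτ, hre, him⟩ := exists_normFormSolution hxy h4.symm
  have hre' : (δ.re : ZMod 89) = 45 * (σ * P.1 - τ * P.2 : ℤ) := by
    rw [← hre, ← him]
    have h89 : (89 : ZMod 89) = 0 := rfl
    push_cast
    linear_combination -(δ.re : ZMod 89) * h89
  have h17 := key 17 (by decide +kernel)
  have h73 := key 73 (by decide +kernel)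
  rw [hre', him] at h17 h73
  exact sieve_neg_691 P hP σ hσ τ hτ Y ⟨h17, h73⟩

/-- Multiplication by `φ ^ 2` on `ℤ[φ]` (coordinates `z + w * φ`), reduced modulo `89 * 199`. -/
def goldenStep (v : ZMod 17711 × ZMod 17711) : ZMod 17711 × ZMod 17711 :=
  (v.1 + v.2, v.1 + 2 * v.2)

/-- Representatives `z + w * φ` of the elements of norm `691` and `-691` up to powers of `φ ^ 2`. -/
def goldenBase : List (ℤ × ℤ) := [(25, 3), (25, 22), (28, 31), (-3, 25), (3, 28)]

lemma golden_base_case :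
    ∀ w ∈ Finset.Icc (0 : ℤ) 36, ∀ z ∈ Finset.Icc (-40 : ℤ) 140, 0 ≤ w + 2 * z →
      (z ^ 2 + z * w - w ^ 2 = 691 ∨ z ^ 2 + z * w - w ^ 2 = -691) → (z, w) ∈ goldenBase := by
  decide +kernel

lemma golden_orbit (n : ℕ) : ∀ z w : ℤ, w.toNat = n → 0 ≤ w → 0 ≤ w + 2 * z →
    (z ^ 2 + z * w - w ^ 2 = 691 ∨ z ^ 2 + z * w - w ^ 2 = -691) →
    ∃ v ∈ goldenBase, ∃ k : ℕ, ((z : ZMod 17711), (w : ZMod 17711)) =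
      goldenStep^[k] ((v.1 : ZMod 17711), (v.2 : ZMod 17711)) := by
  induction n using Nat.strong_induction_on with
  | _ n ih =>
    intro z w hn hw hy h
    by_cases hsmall : w ≤ 36
    · refine ⟨(z, w), golden_base_case w (Finset.mem_Icc.2 ⟨hw, hsmall⟩) z
        (Finset.mem_Icc.2 ⟨by omega, ?_⟩) hy h, 0, rfl⟩
      rcases h with h | h <;> nlinarith
    · push Not at hsmall
      have h₁ : 0 < z := by rcases h with h | h <;> nlinarith
      have h₂ : z < w := by rcases h with h | h <;> nlinarith
      have h₃ : w ≤ 3 * z := by rcases h with h | h <;> nlinarith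
      obtain ⟨v, hv, k, hk⟩ := ih (w - z).toNat (by omega) (2 * z - w) (w - z) rfl (by omega)
        (by omega) (by rcases h with h | h <;> [left; right] <;> linear_combination h)
      refine ⟨v, hv, k + 1, ?_⟩
      rw [Function.iterate_succ_apply', ← hk, goldenStep]
      ext <;> push_cast <;> ring

lemma goldenStep_periodic :
    ∀ v ∈ goldenBase, Function.IsPeriodicPt goldenStep 22
      ((v.1 : ZMod 17711), (v.2 : ZMod 17711)) := by
  unfold Function.IsPeriodicPt Function.IsFixedPt
  decide +kernel

lemma goldenStep_sieve :
    ∀ v ∈ goldenBase, ∀ k < 22,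
      let w := (goldenStep^[k] ((v.1 : ZMod 17711), (v.2 : ZMod 17711))).2.val
      ¬ ((w ^ 8 % 89 = 0 ∨ w ^ 8 % 89 = 1) ∧ (w ^ 18 % 199 = 0 ∨ w ^ 18 % 199 = 1)) := by
  decide +kernel

lemma golden_norm_ne {X z : ℤ} (hX : 0 ≤ X) (hz : 0 ≤ X ^ 11 + 2 * z) :
    ¬ (z ^ 2 + z * X ^ 11 - (X ^ 11) ^ 2 = 691 ∨ z ^ 2 + z * X ^ 11 - (X ^ 11) ^ 2 = -691) := by
  intro h
  obtain ⟨v, hv, k, hk⟩ := golden_orbit _ z (X ^ 11) rfl (by positivity) hz h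
  refine goldenStep_sieve v hv (k % 22) (Nat.mod_lt _ (by norm_num)) ?_
  rw [(goldenStep_periodic v hv).iterate_mod_apply, ← hk]
  lift X to ℕ using hX
  have hval : (((X : ℤ) ^ 11 : ℤ) : ZMod 17711).val = X ^ 11 % 17711 := by
    rw [← ZMod.val_natCast]; push_cast; rfl
  simp only [hval]
  generalize X = x
  rw [Nat.pow_mod, Nat.mod_mod_of_dvd _ (by norm_num), ← Nat.pow_mod,
    Nat.pow_mod (_ % 17711) 18, Nat.mod_mod_of_dvd _ (by norm_num), ← Nat.pow_mod]
  have h89 : ∀ r < 89, (r ^ 11) ^ 8 % 89 = 0 ∨ (r ^ 11) ^ 8 % 89 = 1 := by decide +kernel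
  have h199 : ∀ r < 199, (r ^ 11) ^ 18 % 199 = 0 ∨ (r ^ 11) ^ 18 % 199 = 1 := by decide +kernel
  have h₁ := h89 (x % 89) (Nat.mod_lt _ (by norm_num))
  have h₂ := h199 (x % 199) (Nat.mod_lt _ (by norm_num))
  rw [← pow_mul, ← Nat.pow_mod, pow_mul] at h₁ h₂
  exact ⟨h₁, h₂⟩

theorem sq_ne_five_mul_pow (X Y : ℤ) :
    Y ^ 2 ≠ 5 * X ^ 22 + 2764 ∧ Y ^ 2 ≠ 5 * X ^ 22 - 2764 := by
  rw [← not_or]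
  intro h
  have hpow : |X| ^ 22 = X ^ 22 := Even.pow_abs (by decide) X
  rw [← hpow, ← sq_abs Y] at h
  obtain ⟨z, hz⟩ : ∃ z, |Y| = |X| ^ 11 + 2 * z := by
    have h2 : Even (|Y| ^ 2 - (|X| ^ 11) ^ 2) := by
      rcases h with h | h
      · exact ⟨2 * |X| ^ 22 + 1382, by linear_combination h⟩
      · exact ⟨2 * |X| ^ 22 - 1382, by linear_combination h⟩
    have h3 : Even (|Y| - |X| ^ 11) := by
      rw [Int.even_sub, Int.even_pow' two_ne_zero, Int.even_pow' two_ne_zero] at h2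
      rwa [Int.even_sub]
    obtain ⟨z, hz⟩ := h3
    exact ⟨z, by linarith⟩
  refine golden_norm_ne (abs_nonneg X) (z := z) (by rw [← hz]; exact abs_nonneg Y) ?_
  rw [hz] at h
  rcases h with h | h
  · left; nlinarith
  · right; nlinarith

theorem stmt18 (X Y : ℤ) :
    Y ^ 2 ≠ X ^ 11 + 691 ∧ Y ^ 2 ≠ X ^ 11 - 691 ∧
    Y ^ 2 ≠ 5 * X ^ 22 + 2764 ∧ Y ^ 2 ≠ 5 * X ^ 22 - 2764 :=
  ⟨sq_ne_pow_eleven_add X Y, sq_ne_pow_eleven_sub X Y, sq_ne_five_mul_pow X Y⟩
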